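/- Shared-eigenvector property of the symmetric Kronecker product: let A, B ∈ ℝ^{n×n} and suppose x, y ∈ ℝⁿ are nonzero vectors with A x = λ₁ x, B x = μ₁ x, A y = λ₂ y, B y = μ₂ y for real scalars λ₁, μ₁, λ₂, μ₂. Then x ⊗ₛ y ∈ ℝ^{n̄} is nonzero and (A ⊗ₛ B)(x ⊗ₛ y) = ½ (λ₁ μ₂ + λ₂ μ₁) (x ⊗ₛ y); i.e., x ⊗ₛ y is an eigenvector of A ⊗ₛ B with eigenvalue ½ (λ₁ μ₂ + λ₂ μ₁). -/

import Mathlib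

open Matrix

noncomputable section

/-- `n̄ = n(n+1)/2`, the dimension of the space of symmetric `n × n` matrices. -/
def triDim (n : ℕ) : ℕ := n * (n + 1) / 2

/-- The (0-based) row/column pair `(r(j), c(j))` of the `j`-th position in the
lexicographic (left-to-right, top-to-bottom) enumeration of the on-or-above-diagonal
positions of an `n × n` matrix. -/
def rcPair : ℕ → ℕ → ℕ × ℕ
  | 0, _ => (0, 0)
  | (m + 1), j =>
      if j < m + 1 then (0, j)
      else ((rcPair m (j - (m + 1))).1 + 1, (rcPair m (j - (m + 1))).2 + 1)

/-- The orthonormal basis `E_j` of the space of symmetric `n × n` matrices: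
`E_j = e_{r(j)} e_{c(j)}ᵀ` if `r(j) = c(j)`, and
`E_j = (√2/2) (e_{r(j)} e_{c(j)}ᵀ + e_{c(j)} e_{r(j)}ᵀ)` if `r(j) < c(j)`. -/
def symBasis (n : ℕ) (j : Fin (triDim n)) : Matrix (Fin n) (Fin n) ℝ :=
  if (rcPair n j).1 = (rcPair n j).2 then
    Matrix.of fun a b : Fin n =>
      if (a : ℕ) = (rcPair n j).1 ∧ (b : ℕ) = (rcPair n j).2 then (1 : ℝ) else 0
  else
    Matrix.of fun a b : Fin n =>
      if ((a : ℕ) = (rcPair n j).1 ∧ (b : ℕ) = (rcPair n j).2) ∨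
          ((a : ℕ) = (rcPair n j).2 ∧ (b : ℕ) = (rcPair n j).1) then
        Real.sqrt 2 / 2
      else 0

/-- Column-stacking vectorization `vec : ℝ^{m×n} → ℝ^{nm}`: `vec(A)_{j·m + i} = A_{i,j}`
(0-based), realized through `finProdFinEquiv (j, i) = j * m + i`. -/
def mvec {m n : ℕ} (A : Matrix (Fin m) (Fin n) ℝ) : Fin (n * m) → ℝ :=
  fun k => A (finProdFinEquiv.symm k).2 (finProdFinEquiv.symm k).1

/-- The matrix `W_n ∈ ℝ^{n̄ × n²}` whose `j`-th row is `vec(E_j)ᵀ`. -/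
def Wmat (n : ℕ) : Matrix (Fin (triDim n)) (Fin (n * n)) ℝ :=
  Matrix.of fun j k => mvec (symBasis n j) k

/-- The Kronecker product on `Fin`-indexed matrices, with the standard flattening
`(A ⊗ B)_{(i·p + k, j·q + l)} = A_{i,j} B_{k,l}`. -/
def kron {m n p q : ℕ} (A : Matrix (Fin m) (Fin n) ℝ) (B : Matrix (Fin p) (Fin q) ℝ) :
    Matrix (Fin (m * p)) (Fin (n * q)) ℝ :=
  Matrix.reindex finProdFinEquiv finProdFinEquiv (Matrix.kroneckerMap (· * ·) A B)

/-- The symmetric Kronecker product `A ⊗ₛ B = W_m (A ⊗ B) W_nᵀ ∈ ℝ^{m̄ × n̄}`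
of rectangular matrices `A, B ∈ ℝ^{m×n}`. -/
def skron {m n : ℕ} (A B : Matrix (Fin m) (Fin n) ℝ) :
    Matrix (Fin (triDim m)) (Fin (triDim n)) ℝ :=
  Wmat m * kron A B * (Wmat n)ᵀ

/-- The Frobenius inner product `⟨A, B⟩_F = trace(Aᵀ B)`. -/
def frobInner {m n : ℕ} (A B : Matrix (Fin m) (Fin n) ℝ) : ℝ :=
  (Aᵀ * B).trace

/-- Symmetric vectorization `svec(P)_j = ⟨P, E_j⟩_F`. -/
def svec {n : ℕ} (P : Matrix (Fin n) (Fin n) ℝ) : Fin (triDim n) → ℝ :=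
  fun j => frobInner P (symBasis n j)

/-- The symmetric part `π(A) = (A + Aᵀ)/2`. -/
def symPart {n : ℕ} (A : Matrix (Fin n) (Fin n) ℝ) : Matrix (Fin n) (Fin n) ℝ :=
  (1 / 2 : ℝ) • (A + Aᵀ)

/-- The symmetric Kronecker sum `A ⊕ₛ B = A ⊗ₛ I + I ⊗ₛ B`. -/
def skronSum {n : ℕ} (A B : Matrix (Fin n) (Fin n) ℝ) :
    Matrix (Fin (triDim n)) (Fin (triDim n)) ℝ :=
  skron A 1 + skron 1 B

/-- A vector `x ∈ ℝⁿ` regarded as an `n × 1` matrix. -/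
def colVec {n : ℕ} (x : Fin n → ℝ) : Matrix (Fin n) (Fin 1) ℝ :=
  Matrix.of fun i _ => x i

lemma triDim_succ (n : ℕ) : triDim (n + 1) = (n + 1) + triDim n := by
  unfold triDim
  rw [show (n + 1) * (n + 1 + 1) = n * (n + 1) + (n + 1) * 2 by ring,
    Nat.add_mul_div_right _ _ (by norm_num)]
  omega

lemma rcPair_fst_le_snd (n j : ℕ) : (rcPair n j).1 ≤ (rcPair n j).2 := by
  induction n generalizing j with
  | zero => simp [rcPair]
  | succ n ih =>
    rw [rcPair]
    split_ifs
    · simp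
    · simpa using ih _

lemma exists_rcPair_eq {n p q : ℕ} (hpq : p ≤ q) (hq : q < n) :
    ∃ j < triDim n, rcPair n j = (p, q) := by
  induction n generalizing p q with
  | zero => omega
  | succ n ih =>
    rw [triDim_succ]
    rcases p with _ | p
    · exact ⟨q, by omega, by rw [rcPair, if_pos hq]⟩
    · obtain ⟨q, rfl⟩ : ∃ q', q = q' + 1 := ⟨q - 1, by omega⟩
      obtain ⟨j, hj, h⟩ := ih (p := p) (q := q) (by omega) (by omega)
      refine ⟨n + 1 + j, by omega, ?_⟩
      rw [rcPair, if_neg (by omega), Nat.add_sub_cancel_left, h]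

lemma rcPair_injOn {n j k : ℕ} (hj : j < triDim n) (hk : k < triDim n)
    (h : rcPair n j = rcPair n k) : j = k := by
  induction n generalizing j k with
  | zero => simp [triDim] at hj
  | succ n ih =>
    rw [triDim_succ] at hj hk
    rw [rcPair, rcPair] at h
    split_ifs at h with h₁ h₂ h₂
    · simpa using h
    · simp at h
    · simp at h
    · simp only [Prod.mk.injEq, Nat.add_right_cancel_iff] at h
      have := ih (j := j - (n + 1)) (k := k - (n + 1)) (by omega) (by omega) (Prod.ext h.1 h.2)
      omega

lemma symBasis_apply {n : ℕ} (j : Fin (triDim n)) (a b : Fin n) :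
    symBasis n j a b =
      if rcPair n j = (min (a : ℕ) b, max (a : ℕ) b) then
        (if a = b then 1 else Real.sqrt 2 / 2) else 0 := by
  have hle := rcPair_fst_le_snd n j
  unfold symBasis
  generalize rcPair n j = r at hle
  obtain ⟨p, q⟩ := r
  simp only [Prod.mk.injEq, Fin.ext_iff] at *
  split_ifs <;> simp only [of_apply] <;> split_ifs <;> first | rfl | omega

lemma symBasis_comm {n : ℕ} (j : Fin (triDim n)) (a b : Fin n) :
    symBasis n j a b = symBasis n j b a := by
  simp only [symBasis_apply, min_comm (a : ℕ), max_comm (a : ℕ), eq_comm (a := a)]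

lemma sum_symBasis_mul_symBasis {n : ℕ} (a b c d : Fin n) :
    ∑ j, symBasis n j a b * symBasis n j c d =
      (1 / 2 : ℝ) * ((if a = c ∧ b = d then 1 else 0) + (if a = d ∧ b = c then 1 else 0)) := by
  obtain ⟨k, hk, hkr⟩ := exists_rcPair_eq (n := n) (p := min (a : ℕ) b) (q := max (a : ℕ) b)
    (by omega) (by omega)
  rw [Finset.sum_eq_single (⟨k, hk⟩ : Fin (triDim n))]
  · have h2 : Real.sqrt 2 / 2 * (Real.sqrt 2 / 2) = 1 / 2 := by
      have := Real.mul_self_sqrt (show (0 : ℝ) ≤ 2 by norm_num)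
      linarith
    simp only [symBasis_apply, hkr, if_true, Prod.mk.injEq, Fin.ext_iff]
    split_ifs <;> first | omega | (simp only [h2]; norm_num) | norm_num
  · intro j _ hj
    rw [symBasis_apply, if_neg, zero_mul]
    intro h
    exact hj (Fin.ext (rcPair_injOn j.2 hk (h.trans hkr.symm)))
  · simp

lemma sum_mul_Wmat {n : ℕ} (f : Fin (n * n) → ℝ) (j : Fin (triDim n)) :
    ∑ k, Wmat n j k * f k =
      ∑ a, ∑ b, symBasis n j a b * f (finProdFinEquiv (a, b)) := by
  rw [← finProdFinEquiv.sum_comp, Fintype.sum_prod_type]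
  refine Finset.sum_congr rfl fun a _ => Finset.sum_congr rfl fun b _ => ?_
  rw [Wmat, of_apply, mvec, Equiv.symm_apply_apply, symBasis_comm]

lemma skron_apply {m n : ℕ} (A B : Matrix (Fin m) (Fin n) ℝ) (i : Fin (triDim m))
    (j : Fin (triDim n)) :
    skron A B i j = ∑ a, ∑ b, symBasis m i a b *
      ∑ c, ∑ d, symBasis n j c d * (A a c * B b d) := by
  rw [skron, Matrix.mul_assoc, Matrix.mul_apply, sum_mul_Wmat]
  refine Finset.sum_congr rfl fun a _ => Finset.sum_congr rfl fun b _ => ?_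
  rw [Matrix.mul_apply]
  simp only [transpose_apply, mul_comm (kron A B _ _), sum_mul_Wmat]
  simp [kron]

lemma skron_colVec_apply {n : ℕ} (x y : Fin n → ℝ) (i : Fin (triDim n)) (j : Fin (triDim 1)) :
    skron (colVec x) (colVec y) i j = ∑ a, ∑ b, symBasis n i a b * (x a * y b) := by
  have hj : (j : ℕ) < 1 := j.2
  have h : symBasis 1 j 0 0 = 1 := by
    rw [symBasis_apply, show (j : ℕ) = 0 by omega]
    simp [rcPair]
  simp [skron_apply, h, colVec]

lemma sum_symBasis_mul_skron_colVec {n : ℕ} (x y : Fin n → ℝ) (c d : Fin n)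
    (j : Fin (triDim 1)) :
    ∑ i, symBasis n i c d * skron (colVec x) (colVec y) i j =
      (1 / 2 : ℝ) * (x c * y d + x d * y c) := by
  calc ∑ i, symBasis n i c d * skron (colVec x) (colVec y) i j
      = ∑ a, ∑ b, (∑ i, symBasis n i c d * symBasis n i a b) * (x a * y b) := by
        simp only [skron_colVec_apply, Finset.mul_sum, Finset.sum_mul, mul_assoc]
        rw [Finset.sum_comm]
        exact Finset.sum_congr rfl fun a _ => Finset.sum_comm
    _ = (1 / 2 : ℝ) * (x c * y d + x d * y c) := by
        simp only [sum_symBasis_mul_symBasis, mul_add, add_mul, Finset.sum_add_distrib, ite_and]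
        simp

lemma skron_mul_skron_colVec_apply {n : ℕ} (A B : Matrix (Fin n) (Fin n) ℝ) (x y : Fin n → ℝ)
    (i : Fin (triDim n)) (j : Fin (triDim 1)) :
    (skron A B * skron (colVec x) (colVec y)) i j = ∑ a, ∑ b, symBasis n i a b *
      ((1 / 2 : ℝ) * (A.mulVec x a * B.mulVec y b + A.mulVec y a * B.mulVec x b)) := by
  have key (a b : Fin n) :
      ∑ k, (∑ c, ∑ d, symBasis n k c d * (A a c * B b d)) * skron (colVec x) (colVec y) k j =
        (1 / 2 : ℝ) * (A.mulVec x a * B.mulVec y b + A.mulVec y a * B.mulVec x b) := by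
    calc _ = ∑ c, ∑ d, A a c * B b d *
          ∑ k, symBasis n k c d * skron (colVec x) (colVec y) k j := by
          simp only [Finset.mul_sum, Finset.sum_mul]
          rw [Finset.sum_comm]
          refine Finset.sum_congr rfl fun c _ => ?_
          rw [Finset.sum_comm]
          exact Finset.sum_congr rfl fun d _ => Finset.sum_congr rfl fun k _ => by ring
      _ = _ := by
          simp only [sum_symBasis_mul_skron_colVec, mulVec, dotProduct, Finset.sum_mul_sum]
          simp only [← Finset.sum_add_distrib, Finset.mul_sum]
          exact Finset.sum_congr rfl fun c _ => Finset.sum_congr rfl fun d _ => by ring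
  simp only [Matrix.mul_apply, skron_apply A B, ← key, Finset.sum_mul, Finset.mul_sum]
  rw [Finset.sum_comm]
  refine Finset.sum_congr rfl fun a _ => ?_
  rw [Finset.sum_comm]
  simp only [mul_assoc]

lemma skron_colVec_comm {n : ℕ} (x y : Fin n → ℝ) :
    skron (colVec x) (colVec y) = skron (colVec y) (colVec x) := by
  ext i j
  rw [skron_colVec_apply, skron_colVec_apply, Finset.sum_comm]
  refine Finset.sum_congr rfl fun a _ => Finset.sum_congr rfl fun b _ => ?_
  rw [symBasis_comm, mul_comm (x b)]

lemma skron_colVec_ne_zero {n : ℕ} {x y : Fin n → ℝ} (hx : x ≠ 0) (hy : y ≠ 0) :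
    skron (colVec x) (colVec y) ≠ 0 := by
  intro h
  have hz (c d : Fin n) : x c * y d + x d * y c = 0 := by
    have := sum_symBasis_mul_skron_colVec x y c d ⟨0, by simp [triDim]⟩
    simpa [h] using this
  obtain ⟨c, hc⟩ := Function.ne_iff.mp hx
  have hyc : y c = 0 := by
    have := hz c c
    rw [← two_mul] at this
    simpa using (mul_eq_zero.mp (by simpa using this)).resolve_left hc
  refine hy (funext fun d => ?_)
  have := hz c d
  rw [hyc, mul_zero, add_zero] at this
  exact (mul_eq_zero.mp this).resolve_left hc

/-- shared-eigenvector property of the symmetric Kronecker product: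
if `A x = λ₁ x`, `B x = μ₁ x`, `A y = λ₂ y`, `B y = μ₂ y` with `x, y ≠ 0`, then
`x ⊗ₛ y ≠ 0` and `(A ⊗ₛ B)(x ⊗ₛ y) = ½(λ₁ μ₂ + λ₂ μ₁)(x ⊗ₛ y)`. -/
theorem skron_shared_eigenvector (n : ℕ) (A B : Matrix (Fin n) (Fin n) ℝ)
    (x y : Fin n → ℝ) (hx : x ≠ 0) (hy : y ≠ 0) (l₁ m₁ l₂ m₂ : ℝ)
    (hAx : A.mulVec x = l₁ • x) (hBx : B.mulVec x = m₁ • x)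
    (hAy : A.mulVec y = l₂ • y) (hBy : B.mulVec y = m₂ • y) :
    skron (colVec x) (colVec y) ≠ 0 ∧
    skron A B * skron (colVec x) (colVec y) =
      ((1 / 2 : ℝ) * (l₁ * m₂ + l₂ * m₁)) • skron (colVec x) (colVec y) := by
  refine ⟨skron_colVec_ne_zero hx hy, ?_⟩
  ext i j
  rw [skron_mul_skron_colVec_apply, hAx, hBx, hAy, hBy, Matrix.smul_apply, smul_eq_mul]
  calc _ = (1 / 2 : ℝ) * (l₁ * m₂) * skron (colVec x) (colVec y) i j +
        (1 / 2 : ℝ) * (l₂ * m₁) * skron (colVec y) (colVec x) i j := by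
        simp only [skron_colVec_apply, Finset.mul_sum, ← Finset.sum_add_distrib]
        refine Finset.sum_congr rfl fun a _ => Finset.sum_congr rfl fun b _ => ?_
        simp only [Pi.smul_apply, smul_eq_mul]
        ring
    _ = _ := by
        rw [skron_colVec_comm y x]
        ring
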